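/- Let c > 1/2 and δ > 0 be fixed, let k ≥ 3 and fix m with 2 ≤ m ≤ k−1. Then there exist constants C > 0 and ρ ∈ (0,1), depending only on k, c and δ, such that for all n ≥ 1 the following holds: for every m×k matrix D = (d_{ij}) with entries in {0,1,−1} satisfying (i) there are column indices ν_1 < ν_2 < ⋯ < ν_m with d_{i ν_j} = 1 if i = j and 0 otherwise, and d_{ij} = 0 whenever j < ν_i; (ii) every m×m minor of D has determinant in {−1,0,1}; and (iii) at least one column of D contains more than one nonzero entry; one has V_n^{−2kc} ∫_{ℝ^n}⋯∫_{ℝ^n} ∏_{j=1}^k f_{c,δ}( Σ_{i=1}^m d_{ij}·x_i ) dx_1⋯dx_m ≤ C·ρ^n. -/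

import Mathlib

open MeasureTheory

/-- `V_n = π^{n/2} / Γ(n/2 + 1)`, the volume of the unit ball in `ℝⁿ`. -/
noncomputable def unitBallVol (n : ℕ) : ℝ :=
  Real.pi ^ ((n : ℝ) / 2) / Real.Gamma ((n : ℝ) / 2 + 1)

/-- `R_n(δ) = (δ / V_n)^{1/n}`, the radius of a ball of volume `δ` in `ℝⁿ`. -/
noncomputable def cutRadius (n : ℕ) (δ : ℝ) : ℝ :=
  (δ / unitBallVol n) ^ (1 / (n : ℝ))

/-- `f_{c,δ}(x) = |x|^{-2cn}` if `|x| > R_n(δ)`, and `0` otherwise. -/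
noncomputable def truncPower (n : ℕ) (c δ : ℝ) (x : EuclideanSpace ℝ (Fin n)) : ℝ :=
  if cutRadius n δ < ‖x‖ then ‖x‖ ^ (-(2 * c * (n : ℝ))) else 0

open scoped ENNReal

/-- Two points `y`, `s y + w` of the ball of radius `65/64 R` with `|w| ≥ R/2`. -/
lemma npa_mid {E : Type*} [NormedAddCommGroup E] [InnerProductSpace ℝ E] {R s : ℝ}
    (hs : s = 1 ∨ s = -1) (hR : 0 < R) {w y : E} (hw : R / 2 ≤ ‖w‖)
    (h1 : ‖y‖ ≤ 65 / 64 * R) (h2 : ‖s • y + w‖ ≤ 65 / 64 * R) :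
    y ∈ Metric.closedBall (-((s / 2) • w)) (63 / 64 * R) := by
  rw [mem_closedBall_iff_norm, sub_neg_eq_add]
  have hs2 : s * s = 1 := by rcases hs with rfl | rfl <;> norm_num
  have e1 : ‖s • y + w‖ ^ 2 = ‖y‖ ^ 2 + 2 * (s * inner ℝ y w) + ‖w‖ ^ 2 := by
    rw [norm_add_sq_real, norm_smul, real_inner_smul_left, mul_pow, Real.norm_eq_abs, sq_abs,
      pow_two s, hs2, one_mul]
  have e2 : ‖y + (s / 2) • w‖ ^ 2 = ‖y‖ ^ 2 + s * inner ℝ y w + ‖w‖ ^ 2 / 4 := by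
    rw [norm_add_sq_real, norm_smul, real_inner_smul_right, mul_pow, Real.norm_eq_abs, sq_abs]
    linear_combination (‖w‖ ^ 2 / 4) * hs2
  have h3 : ‖y‖ ^ 2 ≤ (65 / 64 * R) ^ 2 := by gcongr
  have h4 : ‖s • y + w‖ ^ 2 ≤ (65 / 64 * R) ^ 2 := by gcongr
  have h5 : (R / 2) ^ 2 ≤ ‖w‖ ^ 2 := by gcongr
  apply le_of_sq_le_sq _ (by positivity)
  nlinarith

lemma npa_one {E : Type*} [NormedAddCommGroup E] [InnerProductSpace ℝ E] [MeasurableSpace E]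
    [BorelSpace E] (μ : Measure E) {F : E → ℝ≥0∞} (hF : Measurable F) {R : ℝ} (hR : 0 < R)
    {M I d r : ℝ≥0∞} (hM : ∀ x, F x ≤ M) (hI : ∫⁻ x, F x ∂μ ≤ I)
    (hT : ∀ x, 65 / 64 * R < ‖x‖ → F x ≤ M * r)
    (hJ : ∫⁻ x in {x | 65 / 64 * R < ‖x‖}, F x ∂μ ≤ I * r)
    (hV : ∀ x, μ (Metric.closedBall x (63 / 64 * R)) ≤ d * r)
    {s : ℝ} (hs : s = 1 ∨ s = -1) {w : E} (hw : R / 2 ≤ ‖w‖) :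
    ∫⁻ y, F y * F (s • y + w) ∂μ ≤ (2 * M * I + M * M * d) * r := by
  have hms : MeasurableSet {x : E | 65 / 64 * R < ‖x‖} :=
    measurableSet_lt measurable_const measurable_norm
  calc ∫⁻ y, F y * F (s • y + w) ∂μ
      ≤ ∫⁻ y, (F y * (M * r) + M * ({x : E | 65 / 64 * R < ‖x‖}.indicator F y)) +
          (Metric.closedBall (-((s / 2) • w)) (63 / 64 * R)).indicator (fun _ => M * M) y ∂μ := by
        apply lintegral_mono
        intro y
        dsimp only
        by_cases h2 : 65 / 64 * R < ‖s • y + w‖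
        · refine le_trans ?_ le_self_add
          refine le_trans ?_ le_self_add
          gcongr
          exact hT _ h2
        by_cases h1 : 65 / 64 * R < ‖y‖
        · refine le_trans ?_ le_self_add
          refine le_trans ?_ le_add_self
          rw [Set.indicator_of_mem (by exact h1), mul_comm]
          gcongr
          exact hM _
        · refine le_trans ?_ le_add_self
          rw [Set.indicator_of_mem (npa_mid hs hR hw (not_lt.1 h1) (not_lt.1 h2))]
          gcongr
          · exact hM _
          · exact hM _
    _ = (∫⁻ y, F y ∂μ) * (M * r) + M * (∫⁻ x in {x | 65 / 64 * R < ‖x‖}, F x ∂μ) +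
          M * M * μ (Metric.closedBall (-((s / 2) • w)) (63 / 64 * R)) := by
        rw [lintegral_add_right _ (measurable_const.indicator measurableSet_closedBall),
          lintegral_add_right _ ((hF.indicator hms).const_mul _),
          lintegral_mul_const _ hF, lintegral_const_mul _ (hF.indicator hms),
          lintegral_indicator hms, lintegral_indicator_const measurableSet_closedBall]
    _ ≤ I * (M * r) + M * (I * r) + M * M * (d * r) := by
        gcongr
        exact hV _
    _ = _ := by ring

lemma npa_two {E : Type*} [NormedAddCommGroup E] [InnerProductSpace ℝ E] [MeasurableSpace E]
    [BorelSpace E] [SecondCountableTopology E]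
    (μ : Measure E) {F : E → ℝ≥0∞} (hF : Measurable F) {R : ℝ} (hR : 0 < R)
    {M I d r : ℝ≥0∞} (hM : ∀ x, F x ≤ M) (hI : ∫⁻ x, F x ∂μ ≤ I)
    (hT : ∀ x, 65 / 64 * R < ‖x‖ → F x ≤ M * r)
    (hJ : ∫⁻ x in {x | 65 / 64 * R < ‖x‖}, F x ∂μ ≤ I * r)
    (hV : ∀ x, μ (Metric.closedBall x (63 / 64 * R)) ≤ d * r)
    {s t : ℝ} (hs : s = 1 ∨ s = -1) (ht : t = 1 ∨ t = -1) (z : E) :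
    ∫⁻ y₁, ∫⁻ y₂, F y₁ * (F y₂ * F (t • y₂ + (s • y₁ + z))) ∂μ ∂μ
      ≤ (2 * M * I * I + 2 * M * M * I * d) * r := by
  have hcomp : ∀ y₁ : E, Measurable fun y₂ => F y₂ * F (t • y₂ + (s • y₁ + z)) := fun y₁ =>
    hF.mul (hF.comp ((measurable_id.const_smul t).add_const _))
  calc _ ≤ ∫⁻ y₁, F y₁ * ((2 * M * I + M * M * d) * r) +
          (Metric.closedBall (-(s • z)) (63 / 64 * R)).indicator (fun _ => M * (I * M)) y₁ ∂μ := by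
        apply lintegral_mono
        intro y₁
        dsimp only
        rw [lintegral_const_mul _ (hcomp y₁)]
        by_cases hw : R / 2 ≤ ‖s • y₁ + z‖
        · refine le_trans ?_ le_self_add
          gcongr
          exact npa_one μ hF hR hM hI hT hJ hV ht hw
        · refine le_trans ?_ le_add_self
          have hmem : y₁ ∈ Metric.closedBall (-(s • z)) (63 / 64 * R) := by
            rw [mem_closedBall_iff_norm, sub_neg_eq_add]
            have : y₁ + s • z = s • (s • y₁ + z) := by
              rcases hs with rfl | rfl <;> simp
            rw [this, norm_smul]
            have : ‖s‖ = 1 := by rcases hs with rfl | rfl <;> simp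
            rw [this]
            push Not at hw
            linarith
          rw [Set.indicator_of_mem hmem]
          gcongr
          · exact hM _
          · calc _ ≤ ∫⁻ y₂, F y₂ * M ∂μ := by
                  apply lintegral_mono
                  intro y
                  dsimp only
                  gcongr
                  exact hM _
              _ = (∫⁻ y₂, F y₂ ∂μ) * M := lintegral_mul_const _ hF
              _ ≤ _ := by gcongr
    _ = (∫⁻ y, F y ∂μ) * ((2 * M * I + M * M * d) * r) +
          M * (I * M) * μ (Metric.closedBall (-(s • z)) (63 / 64 * R)) := by
        rw [lintegral_add_right _ (measurable_const.indicator measurableSet_closedBall),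
          lintegral_mul_const _ hF, lintegral_indicator_const measurableSet_closedBall]
    _ ≤ I * ((2 * M * I + M * M * d) * r) + M * (I * M) * (d * r) := by
        gcongr
        exact hV _
    _ = _ := by ring

lemma npa_lmarg_const {ι E : Type*} [DecidableEq ι] [MeasurableSpace E]
    (μ : Measure E) [SigmaFinite μ] {G : (ι → E) → ℝ≥0∞} (hG : Measurable G) (s : Finset ι)
    (K : ℝ≥0∞) (x : ι → E) :
    (∫⋯∫⁻_s, (fun x => K * G x) ∂(fun _ => μ)) x = K * (∫⋯∫⁻_s, G ∂(fun _ => μ)) x := by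
  unfold lmarginal
  rw [lintegral_const_mul]
  exact hG.comp measurable_updateFinset

lemma npa_lmarg {ι E : Type*} [DecidableEq ι] [MeasurableSpace E]
    (μ : Measure E) [SigmaFinite μ] {F : E → ℝ≥0∞} (hF : Measurable F) {I : ℝ≥0∞}
    (hI : ∫⁻ x, F x ∂μ ≤ I) (s : Finset ι) (x : ι → E) :
    (∫⋯∫⁻_s, (fun x => ∏ i ∈ s, F (x i)) ∂(fun _ => μ)) x ≤ I ^ s.card := by
  have hmeas : ∀ s : Finset ι, Measurable fun x : ι → E => ∏ i ∈ s, F (x i) := fun s =>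
    Finset.measurable_prod _ fun i _ => hF.comp (measurable_pi_apply i)
  induction s using Finset.induction_on generalizing x with
  | empty => simp
  | insert i s hi ih =>
    rw [lmarginal_insert' _ (hmeas _) hi, Finset.card_insert_of_notMem hi, pow_succ, mul_comm]
    refine le_trans (lmarginal_mono (g := fun x => I * ∏ i ∈ s, F (x i)) ?_ x) ?_
    · intro x
      dsimp only
      have : ∀ y, ∏ j ∈ insert i s, F (Function.update x i y j) = F y * ∏ j ∈ s, F (x j) := by
        intro y
        rw [Finset.prod_insert hi, Function.update_self]
        congr 1
        refine Finset.prod_congr rfl fun j hj => ?_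
        rw [Function.update_of_ne (by rintro rfl; exact hi hj)]
      simp_rw [this]
      rw [lintegral_mul_const _ hF]
      gcongr
    · rw [npa_lmarg_const μ (hmeas s)]
      gcongr
      exact ih x

lemma npa_pi {m : ℕ} {E : Type*} [NormedAddCommGroup E] [InnerProductSpace ℝ E]
    [MeasurableSpace E] [BorelSpace E] [SecondCountableTopology E]
    (μ : Measure E) [SigmaFinite μ] {F : E → ℝ≥0∞} (hF : Measurable F) {R : ℝ} (hR : 0 < R)
    {M I d r : ℝ≥0∞} (hM : ∀ x, F x ≤ M) (hI : ∫⁻ x, F x ∂μ ≤ I) (hI1 : 1 ≤ I)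
    (hT : ∀ x, 65 / 64 * R < ‖x‖ → F x ≤ M * r)
    (hJ : ∫⁻ x in {x | 65 / 64 * R < ‖x‖}, F x ∂μ ≤ I * r)
    (hV : ∀ x, μ (Metric.closedBall x (63 / 64 * R)) ≤ d * r)
    (D : Fin m → ℝ) (i₁ i₂ : Fin m) (hne : i₁ ≠ i₂)
    (hs : D i₁ = 1 ∨ D i₁ = -1) (ht : D i₂ = 1 ∨ D i₂ = -1) :
    ∫⁻ x, (∏ i, F (x i)) * F (∑ i, D i • x i) ∂(Measure.pi fun _ : Fin m => μ)
      ≤ (2 * M * I * I + 2 * M * M * I * d) * r * I ^ m := by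
  set H : (Fin m → E) → ℝ≥0∞ := fun x => (∏ i, F (x i)) * F (∑ i, D i • x i) with hH
  have hHm : Measurable H := by
    refine Measurable.mul
      (Finset.measurable_prod _ fun i _ => hF.comp (measurable_pi_apply i)) (hF.comp ?_)
    exact Finset.measurable_sum _ fun i _ => (measurable_pi_apply i).const_smul (D i)
  set s : Finset (Fin m) := Finset.univ \ {i₁, i₂} with hsdef
  have hdisj : Disjoint s {i₁, i₂} := Finset.sdiff_disjoint
  have hun : (Finset.univ : Finset (Fin m)) = s ∪ {i₁, i₂} := by
    rw [hsdef, Finset.sdiff_union_of_subset (Finset.subset_univ _)]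
  have hm1 : i₁ ∉ s := by simp [hsdef]
  have hm2 : i₂ ∉ s := by simp [hsdef]
  have hn : i₁ ∉ ({i₂} : Finset (Fin m)) := by simpa using hne
  have hmeas : Measurable fun x : Fin m → E => ∏ i ∈ s, F (x i) :=
    Finset.measurable_prod _ fun i _ => hF.comp (measurable_pi_apply i)
  have e0 : ∫⁻ x, H x ∂(Measure.pi fun _ : Fin m => μ) =
      (∫⋯∫⁻_s, ∫⋯∫⁻_{i₁, i₂}, H ∂(fun _ => μ) ∂(fun _ => μ)) (fun _ => 0) := by
    rw [lintegral_eq_lmarginal_univ (fun _ => (0 : E)), ← lmarginal_union _ _ hHm hdisj, ← hun]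
  rw [e0]
  refine le_trans (lmarginal_mono
    (g := fun x => (2 * M * I * I + 2 * M * M * I * d) * r * ∏ i ∈ s, F (x i)) ?_ _) ?_
  · intro x
    dsimp only
    rw [lmarginal_insert _ hHm hn, lmarginal_singleton]
    have key : ∀ y₁ y₂, H (Function.update (Function.update x i₁ y₁) i₂ y₂) =
        (∏ i ∈ s, F (x i)) * (F y₁ * (F y₂ * F (D i₂ • y₂ + (D i₁ • y₁ + ∑ i ∈ s, D i • x i)))) := by
      intro y₁ y₂
      have hu : ∀ i ∈ s, Function.update (Function.update x i₁ y₁) i₂ y₂ i = x i := by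
        intro i hi
        rw [Function.update_of_ne (by rintro rfl; exact hm2 hi),
          Function.update_of_ne (by rintro rfl; exact hm1 hi)]
      have hu1 : Function.update (Function.update x i₁ y₁) i₂ y₂ i₁ = y₁ := by
        rw [Function.update_of_ne hne, Function.update_self]
      have hu2 : Function.update (Function.update x i₁ y₁) i₂ y₂ i₂ = y₂ :=
        Function.update_self _ _ _
      simp only [hH]
      rw [hun, Finset.prod_union hdisj, Finset.sum_union hdisj, Finset.prod_pair hne,
        Finset.sum_pair hne, hu1, hu2, Finset.prod_congr rfl (fun i hi => by rw [hu i hi]),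
        Finset.sum_congr rfl (fun i hi => by rw [hu i hi]), mul_assoc, mul_assoc]
      congr 4
      abel_nf
    simp_rw [key]
    have hm3 : ∀ z : E, Measurable (Function.uncurry fun y₁ y₂ : E =>
        F y₁ * (F y₂ * F (D i₂ • y₂ + (D i₁ • y₁ + z)))) := by
      intro z
      refine (hF.comp measurable_fst).mul ((hF.comp measurable_snd).mul (hF.comp ?_))
      exact (measurable_snd.const_smul (D i₂)).add ((measurable_fst.const_smul (D i₁)).add_const _)
    have hm4 : ∀ z y₁ : E, Measurable (fun y₂ : E =>
        F y₁ * (F y₂ * F (D i₂ • y₂ + (D i₁ • y₁ + z)))) :=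
      fun z y₁ => (hm3 z).comp measurable_prodMk_left
    simp_rw [lintegral_const_mul _ (hm4 _ _)]
    have hm5 : Measurable fun y₁ : E => ∫⁻ y₂, F y₁ * (F y₂ * F (D i₂ • y₂ +
        (D i₁ • y₁ + ∑ i ∈ s, D i • x i))) ∂μ := (hm3 _).lintegral_prod_right'
    rw [lintegral_const_mul _ hm5, mul_comm]
    gcongr
    exact npa_two μ hF hR hM hI hT hJ hV hs ht _
  · rw [npa_lmarg_const μ hmeas]
    gcongr
    refine (npa_lmarg μ hF hI s _).trans ?_
    exact pow_le_pow_right₀ hI1 ((Finset.card_le_univ s).trans (by simp))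

/-- Normalized `V_n^{-2c} f_{c,δ}`, with values in `[0,∞]`. -/
noncomputable def npaF (n : ℕ) (c δ : ℝ) (x : EuclideanSpace ℝ (Fin n)) : ℝ≥0∞ :=
  ENNReal.ofReal (unitBallVol n ^ (-(2 * c)) * truncPower n c δ x)

lemma npa_V_pos (n : ℕ) : 0 < unitBallVol n := by
  unfold unitBallVol
  have := Real.Gamma_pos_of_pos (s := (n : ℝ) / 2 + 1) (by positivity)
  have := Real.pi_pos
  positivity

lemma npa_R_pos (n : ℕ) {δ : ℝ} (hδ : 0 < δ) : 0 < cutRadius n δ := by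
  have := npa_V_pos n
  unfold cutRadius
  positivity

lemma npa_R_pow {n : ℕ} (hn : 1 ≤ n) {δ : ℝ} (hδ : 0 < δ) :
    unitBallVol n * cutRadius n δ ^ n = δ := by
  have := npa_V_pos n
  unfold cutRadius
  rw [one_div, Real.rpow_inv_natCast_pow (by positivity) (by omega)]
  field_simp

lemma npa_trunc_nonneg (n : ℕ) (c δ : ℝ) (x : EuclideanSpace ℝ (Fin n)) :
    0 ≤ truncPower n c δ x := by
  unfold truncPower
  split_ifs <;> positivity

lemma npa_trunc_meas (n : ℕ) (c δ : ℝ) : Measurable (truncPower n c δ) := by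
  unfold truncPower
  refine Measurable.ite (measurableSet_lt measurable_const measurable_norm) ?_ measurable_const
  exact measurable_norm.pow_const _

lemma npaF_meas (n : ℕ) (c δ : ℝ) : Measurable (npaF n c δ) :=
  ((npa_trunc_meas n c δ).const_mul _).ennreal_ofReal

/-- `V^{-2c} (aR)^{-2cn} = δ^{-2c} (a^{-2c})^n`. -/
lemma npa_scale {n : ℕ} (hn : 1 ≤ n) {c δ a : ℝ} (hδ : 0 < δ) (ha : 0 < a) :
    unitBallVol n ^ (-(2 * c)) * (a * cutRadius n δ) ^ (-(2 * c * (n : ℝ)))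
      = δ ^ (-(2 * c)) * (a ^ (-(2 * c))) ^ n := by
  have hV := npa_V_pos n
  have hR := npa_R_pos n hδ
  rw [Real.mul_rpow ha.le hR.le]
  have h1 : ∀ b : ℝ, 0 < b → b ^ (-(2 * c * (n : ℝ))) = (b ^ n) ^ (-(2 * c)) := by
    intro b hb
    rw [← Real.rpow_natCast, ← Real.rpow_mul hb.le]
    congr 1
    ring
  have h2 : (a ^ (-(2 * c))) ^ n = a ^ (-(2 * c * (n : ℝ))) := by
    rw [← Real.rpow_natCast, ← Real.rpow_mul ha.le]
    congr 1
    ring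
  rw [h2, h1 (cutRadius n δ) hR]
  conv_rhs => rw [← npa_R_pow hn hδ, Real.mul_rpow hV.le (by positivity)]
  ring

lemma npaF_tail {n : ℕ} (hn : 1 ≤ n) {c δ a : ℝ} (hc : 1 / 2 < c) (hδ : 0 < δ) (ha : 0 < a)
    (x : EuclideanSpace ℝ (Fin n)) (hx : a * cutRadius n δ < ‖x‖) :
    npaF n c δ x ≤ ENNReal.ofReal (δ ^ (-(2 * c)) * (a ^ (-(2 * c))) ^ n) := by
  have hV := npa_V_pos n
  have hR := npa_R_pos n hδ
  unfold npaF
  apply ENNReal.ofReal_le_ofReal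
  rw [← npa_scale hn hδ ha]
  gcongr
  unfold truncPower
  split_ifs
  · apply Real.rpow_le_rpow_of_nonpos (by positivity) hx.le
    have : 0 ≤ c * n := by positivity
    linarith
  · positivity

lemma npaF_le {n : ℕ} (hn : 1 ≤ n) {c δ : ℝ} (hc : 1 / 2 < c) (hδ : 0 < δ)
    (x : EuclideanSpace ℝ (Fin n)) :
    npaF n c δ x ≤ ENNReal.ofReal (δ ^ (-(2 * c))) := by
  by_cases hx : 1 * cutRadius n δ < ‖x‖
  · simpa using npaF_tail hn hc hδ one_pos x hx
  · rw [one_mul] at hx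
    simp [npaF, truncPower, hx]

lemma npa_ball {n : ℕ} (hn : 1 ≤ n) {δ b : ℝ} (hδ : 0 < δ) (hb : 0 < b)
    (x : EuclideanSpace ℝ (Fin n)) :
    volume (Metric.closedBall x (b * cutRadius n δ)) = ENNReal.ofReal (δ * b ^ n) := by
  have hV := npa_V_pos n
  have hR := npa_R_pos n hδ
  have hv : √Real.pi ^ n / Real.Gamma (n / 2 + 1) = unitBallVol n := by
    unfold unitBallVol
    rw [Real.sqrt_eq_rpow, ← Real.rpow_natCast, ← Real.rpow_mul Real.pi_pos.le]
    congr 2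
    ring
  have : Nonempty (Fin n) := ⟨⟨0, by omega⟩⟩
  rw [EuclideanSpace.volume_closedBall, Fintype.card_fin, hv, ← ENNReal.ofReal_pow (by positivity),
    ← ENNReal.ofReal_mul (by positivity)]
  congr 1
  conv_rhs => rw [← npa_R_pow hn hδ]
  ring

lemma npaF_int {n : ℕ} (hn : 1 ≤ n) {c δ a : ℝ} (hc : 1 / 2 < c) (hδ : 0 < δ) (ha : 1 ≤ a) :
    ∫⁻ x in {x | a * cutRadius n δ < ‖x‖}, npaF n c δ x
      = ENNReal.ofReal (δ ^ (1 - 2 * c) / (2 * c - 1) * (a ^ (1 - 2 * c)) ^ n) := by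
  have hV := npa_V_pos n
  have hR := npa_R_pos n hδ
  have ha0 : 0 < a := by linarith
  have hn0 : (1 : ℝ) ≤ n := by exact_mod_cast hn
  have : Nonempty (Fin n) := ⟨⟨0, by omega⟩⟩
  have haR : 0 < a * cutRadius n δ := by positivity
  have hms : MeasurableSet {x : EuclideanSpace ℝ (Fin n) | a * cutRadius n δ < ‖x‖} :=
    measurableSet_lt measurable_const measurable_norm
  set g : ℝ → ℝ := (Set.Ioi (a * cutRadius n δ)).indicator
    (fun y => unitBallVol n ^ (-(2 * c)) * y ^ (-(2 * c * (n : ℝ)))) with hg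
  have hg0 : ∀ y, 0 ≤ g y := by
    intro y
    apply Set.indicator_nonneg
    intro y hy
    have : 0 < y := haR.trans hy
    positivity
  have e1 : ∀ x : EuclideanSpace ℝ (Fin n),
      {x | a * cutRadius n δ < ‖x‖}.indicator (npaF n c δ) x = ENNReal.ofReal (g ‖x‖) := by
    intro x
    by_cases hx : a * cutRadius n δ < ‖x‖
    · have hx' : cutRadius n δ < ‖x‖ := by nlinarith
      rw [Set.indicator_of_mem (by exact hx), hg, Set.indicator_of_mem (by exact hx), npaF,
        truncPower, if_pos hx']
    · rw [Set.indicator_of_notMem (by exact hx), hg, Set.indicator_of_notMem (by exact hx),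
        ENNReal.ofReal_zero]
  have hexp : (n : ℝ) - 1 - 2 * c * n < -1 := by nlinarith
  have e2 : ∀ y : ℝ, y ^ (n - 1) • g y = (Set.Ioi (a * cutRadius n δ)).indicator
    (fun y => unitBallVol n ^ (-(2 * c)) * y ^ ((n : ℝ) - 1 - 2 * c * n)) y := by
    intro y
    by_cases hy : y ∈ Set.Ioi (a * cutRadius n δ)
    · have hy0 : 0 < y := haR.trans hy
      rw [hg, Set.indicator_of_mem hy, Set.indicator_of_mem hy, smul_eq_mul, ← Real.rpow_natCast,
        Nat.cast_sub hn, sub_eq_add_neg ((n : ℝ) - 1), Real.rpow_add hy0, Nat.cast_one]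
      ring
    · rw [hg, Set.indicator_of_notMem hy, Set.indicator_of_notMem hy, smul_zero]
  have hsub : Set.Ioi (a * cutRadius n δ) ∩ Set.Ioi 0 = Set.Ioi (a * cutRadius n δ) :=
    Set.inter_eq_left.2 (Set.Ioi_subset_Ioi haR.le)
  have hint : Integrable (fun x : EuclideanSpace ℝ (Fin n) => g ‖x‖) := by
    rw [integrable_fun_norm_addHaar volume (f := g), finrank_euclideanSpace_fin]
    simp_rw [e2]
    rw [IntegrableOn, integrable_indicator_iff measurableSet_Ioi, IntegrableOn,
      Measure.restrict_restrict measurableSet_Ioi, hsub]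
    exact (integrableOn_Ioi_rpow_of_lt hexp haR).const_mul _
  have hball : (volume : Measure (EuclideanSpace ℝ (Fin n))).real (Metric.ball 0 1)
      = unitBallVol n := by
    have := npa_ball hn (b := 1) hV one_pos (0 : EuclideanSpace ℝ (Fin n))
    have hc1 : cutRadius n (unitBallVol n) = 1 := by
      unfold cutRadius
      rw [div_self hV.ne', Real.one_rpow]
    rw [hc1] at this
    rw [Measure.real, ← Measure.addHaar_closedBall_eq_addHaar_ball, ← mul_one (1 : ℝ), this]
    simp [hV.le]
  rw [← lintegral_indicator hms]
  simp_rw [e1]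
  rw [← ofReal_integral_eq_lintegral_ofReal hint (Filter.Eventually.of_forall fun x => hg0 _)]
  congr 1
  rw [integral_fun_norm_addHaar volume g, finrank_euclideanSpace_fin, hball]
  simp_rw [e2]
  rw [integral_indicator measurableSet_Ioi, Measure.restrict_restrict measurableSet_Ioi, hsub,
    integral_const_mul, integral_Ioi_rpow_of_lt hexp haR]
  have hs := npa_scale hn (c := c) hδ ha0
  have h3 : (a * cutRadius n δ) ^ ((n : ℝ) - 1 - 2 * c * n + 1)
      = (a * cutRadius n δ) ^ (-(2 * c * (n : ℝ))) * (a * cutRadius n δ) ^ n := by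
    rw [← Real.rpow_natCast, ← Real.rpow_add haR]
    congr 1
    ring
  have h4 : δ ^ (1 - 2 * c) = δ * δ ^ (-(2 * c)) := by
    rw [sub_eq_add_neg, Real.rpow_add hδ, Real.rpow_one]
  have h5 : a ^ (1 - 2 * c) = a * a ^ (-(2 * c)) := by
    rw [sub_eq_add_neg, Real.rpow_add ha0, Real.rpow_one]
  have h6 : (n : ℝ) - 1 - 2 * c * n + 1 = - (n * (2 * c - 1)) := by ring
  have h7 : 2 * c - 1 ≠ 0 := by linarith
  have h8 : (n : ℝ) ≠ 0 := by linarith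
  rw [h3, h4, h5, h6, nsmul_eq_mul, smul_eq_mul, mul_pow, mul_pow, neg_div_neg_eq]
  have h9 := npa_R_pow hn hδ
  calc _ = (unitBallVol n ^ (-(2 * c)) * (a * cutRadius n δ) ^ (-(2 * c * (n : ℝ)))) *
        (unitBallVol n * cutRadius n δ ^ n) * a ^ n / (2 * c - 1) := by
        field_simp
    _ = _ := by
        rw [hs, h9]
        field_simp

lemma npa_cols {k m n : ℕ} {F : EuclideanSpace ℝ (Fin n) → ℝ≥0∞} {M : ℝ≥0∞}
    (hM : ∀ x, F x ≤ M) (hM1 : 1 ≤ M) (D : Matrix (Fin m) (Fin k) ℤ) (ν : Fin m → Fin k)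
    (hν : StrictMono ν) (hD : ∀ i i' : Fin m, D i (ν i') = if i = i' then 1 else 0)
    (j₀ : Fin k) (hj : ∀ i, ν i ≠ j₀) (x : Fin m → EuclideanSpace ℝ (Fin n)) :
    ∏ j : Fin k, F (∑ i : Fin m, (D i j : ℝ) • x i) ≤
      M ^ k * ((∏ i, F (x i)) * F (∑ i : Fin m, (D i j₀ : ℝ) • x i)) := by
  classical
  have hpiv : ∀ i', ∑ i : Fin m, (D i (ν i') : ℝ) • x i = x i' := by
    intro i'
    simp [hD]
  have hnot : j₀ ∉ Finset.univ.image ν := by simpa using hj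
  rw [← Finset.prod_sdiff (Finset.subset_univ (insert j₀ (Finset.univ.image ν))),
    Finset.prod_insert hnot, Finset.prod_image (fun a _ b _ h => hν.injective h)]
  simp_rw [hpiv]
  rw [mul_comm (∏ i, F (x i))]
  gcongr
  calc _ ≤ ∏ _j ∈ Finset.univ \ insert j₀ (Finset.univ.image ν), M :=
        Finset.prod_le_prod' fun _ _ => hM _
    _ = M ^ (Finset.univ \ insert j₀ (Finset.univ.image ν)).card := Finset.prod_const _
    _ ≤ M ^ k := pow_le_pow_right₀ hM1 ((Finset.card_le_univ _).trans (by simp))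

/-- for `(ν,μ)`-admissible `{0,±1}`-matrices `D` with `q = 1`, `M(D) = 1`
(all `m×m` minors have determinant in `{-1,0,1}`), and at least one column with more than
one nonzero entry, the normalized integral
`V_n^{-2kc} ∫⋯∫ ∏_j f_{c,δ}(Σ_i d_{ij} x_i) dx_1⋯dx_m` decays exponentially in `n`,
uniformly in `D`. -/
theorem non_product_admissible_integral_bound
    (c δ : ℝ) (hc : 1 / 2 < c) (hδ : 0 < δ)
    (k m : ℕ) (hk : 3 ≤ k) (hm2 : 2 ≤ m) (hmk : m ≤ k - 1) :
    ∃ C ρ : ℝ, 0 < C ∧ ρ ∈ Set.Ioo (0 : ℝ) 1 ∧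
      ∀ n : ℕ, 1 ≤ n →
      ∀ D : Matrix (Fin m) (Fin k) ℤ,
        (∀ i j, D i j = 0 ∨ D i j = 1 ∨ D i j = -1) →
        (∃ ν : Fin m → Fin k, StrictMono ν ∧
          (∀ i i' : Fin m, D i (ν i') = if i = i' then 1 else 0) ∧
          (∀ (i : Fin m) (j : Fin k), j < ν i → D i j = 0)) →
        (∀ g : Fin m → Fin k,
          (D.submatrix id g).det = 0 ∨ (D.submatrix id g).det = 1 ∨
            (D.submatrix id g).det = -1) →
        (∃ j : Fin k, ∃ i₁ i₂ : Fin m, i₁ ≠ i₂ ∧ D i₁ j ≠ 0 ∧ D i₂ j ≠ 0) →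
        unitBallVol n ^ (-(2 * (k : ℝ) * c)) *
          ∫ x : Fin m → EuclideanSpace ℝ (Fin n),
            ∏ j : Fin k, truncPower n c δ (∑ i : Fin m, (D i j : ℝ) • x i)
        ≤ C * ρ ^ n := by
  set a : ℝ := 65 / 64 with ha
  set ρ : ℝ := max (a ^ (1 - 2 * c)) (63 / 64) with hρ
  have ha0 : 0 < a := by norm_num [ha]
  have ha1 : 1 < a := by norm_num [ha]
  have hρ1 : ρ < 1 := by
    refine max_lt ?_ (by norm_num)
    exact Real.rpow_lt_one_of_one_lt_of_neg ha1 (by linarith)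
  have hρ0 : 0 < ρ := lt_of_lt_of_le (by norm_num) (le_max_right _ _)
  set M : ℝ≥0∞ := ENNReal.ofReal (δ ^ (-(2 * c))) + 1 with hMdef
  set I : ℝ≥0∞ := ENNReal.ofReal (δ ^ (1 - 2 * c) / (2 * c - 1)) + 1 with hIdef
  set d : ℝ≥0∞ := ENNReal.ofReal δ with hd
  set K : ℝ≥0∞ := M ^ k * ((2 * M * I * I + 2 * M * M * I * d) * I ^ m) with hK
  have hMt : M ≠ ∞ := by simp [hMdef]
  have hIt : I ≠ ∞ := by simp [hIdef]
  have hdt : d ≠ ∞ := by simp [hd]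
  have hKt : K ≠ ∞ := by finiteness
  have hM1 : 1 ≤ M := le_add_self
  have hI1 : 1 ≤ I := le_add_self
  have hc1 : 0 < 2 * c - 1 := by linarith
  refine ⟨K.toReal + 1, ρ, by positivity, ⟨hρ0, hρ1⟩, ?_⟩
  intro n hn D hent hpiv _ hcol
  obtain ⟨ν, hν, hD, _⟩ := hpiv
  obtain ⟨j₀, i₁, i₂, hne, h1, h2⟩ := hcol
  have hV := npa_V_pos n
  have hR := npa_R_pos n hδ
  have hj : ∀ i, ν i ≠ j₀ := by
    rintro i rfl
    rw [hD] at h1 h2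
    apply hne
    rw [ite_ne_right_iff] at h1 h2
    exact h1.1.trans h2.1.symm
  set r : ℝ≥0∞ := ENNReal.ofReal (ρ ^ n) with hr
  have hF := npaF_meas n c δ
  have hMx : ∀ x, npaF n c δ x ≤ M := fun x => (npaF_le hn hc hδ x).trans le_self_add
  have hT : ∀ x, a * cutRadius n δ < ‖x‖ → npaF n c δ x ≤ M * r := by
    intro x hx
    refine (npaF_tail hn hc hδ ha0 x hx).trans ?_
    rw [ENNReal.ofReal_mul (by positivity)]
    gcongr
    · exact le_self_add
    · rw [hr]
      apply ENNReal.ofReal_le_ofReal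
      gcongr
      refine le_trans ?_ (le_max_left _ _)
      exact Real.rpow_le_rpow_of_exponent_le ha1.le (by linarith)
  have hJ : ∫⁻ x in {x | a * cutRadius n δ < ‖x‖}, npaF n c δ x ≤ I * r := by
    rw [npaF_int hn hc hδ ha1.le, ENNReal.ofReal_mul (by positivity)]
    gcongr
    · exact le_self_add
    · rw [hr]
      apply ENNReal.ofReal_le_ofReal
      gcongr
      exact le_max_left _ _
  have hI : ∫⁻ x, npaF n c δ x ≤ I := by
    have h := npaF_int hn hc hδ (le_refl (1 : ℝ))
    rw [Real.one_rpow, one_pow, mul_one, one_mul] at h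
    rw [hIdef, ← h]
    refine le_trans (le_of_eq ?_) le_self_add
    rw [← lintegral_indicator (measurableSet_lt measurable_const measurable_norm)]
    congr 1
    ext x
    by_cases hx : cutRadius n δ < ‖x‖
    · rw [Set.indicator_of_mem (by exact hx)]
    · rw [Set.indicator_of_notMem (by exact hx)]
      simp [npaF, truncPower, hx]
  have hVol : ∀ x : EuclideanSpace ℝ (Fin n),
      volume (Metric.closedBall x (63 / 64 * cutRadius n δ)) ≤ d * r := by
    intro x
    rw [npa_ball hn hδ (by norm_num), ENNReal.ofReal_mul hδ.le, hr]
    gcongr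
    exact le_max_right _ _
  have hsg : ∀ i, D i j₀ ≠ 0 → ((D i j₀ : ℝ) = 1 ∨ (D i j₀ : ℝ) = -1) := by
    intro i hi
    rcases hent i j₀ with h | h | h
    · exact absurd h hi
    · left; simp [h]
    · right; simp [h]
  have hmain : ∫⁻ x : Fin m → EuclideanSpace ℝ (Fin n),
      ∏ j : Fin k, npaF n c δ (∑ i : Fin m, (D i j : ℝ) • x i) ≤ K * r := by
    have hb := npa_pi volume hF hR hMx hI hI1 hT hJ hVol (fun i => (D i j₀ : ℝ)) i₁ i₂ hne
      (hsg i₁ h1) (hsg i₂ h2)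
    calc _ ≤ ∫⁻ x : Fin m → EuclideanSpace ℝ (Fin n), M ^ k *
          ((∏ i, npaF n c δ (x i)) * npaF n c δ (∑ i : Fin m, (D i j₀ : ℝ) • x i)) :=
          lintegral_mono fun x => npa_cols hMx hM1 D ν hν hD j₀ hj x
      _ = M ^ k * ∫⁻ x : Fin m → EuclideanSpace ℝ (Fin n),
          ((∏ i, npaF n c δ (x i)) * npaF n c δ (∑ i : Fin m, (D i j₀ : ℝ) • x i)) :=
          lintegral_const_mul' _ _ (by finiteness)
      _ ≤ M ^ k * ((2 * M * I * I + 2 * M * M * I * d) * r * I ^ m) := by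
          gcongr
          exact hb
      _ = K * r := by rw [hK]; ring
  have hmeas : Measurable fun x : Fin m → EuclideanSpace ℝ (Fin n) =>
      ∏ j : Fin k, truncPower n c δ (∑ i : Fin m, (D i j : ℝ) • x i) := by
    refine Finset.measurable_prod _ fun j _ => (npa_trunc_meas n c δ).comp ?_
    exact Finset.measurable_sum _ fun i _ => (measurable_pi_apply i).const_smul (D i j : ℝ)
  have hpow : unitBallVol n ^ (-(2 * (k : ℝ) * c)) = (unitBallVol n ^ (-(2 * c))) ^ k := by
    rw [← Real.rpow_natCast, ← Real.rpow_mul hV.le]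
    congr 1
    ring
  rw [← integral_const_mul, integral_eq_lintegral_of_nonneg_ae
    (Filter.Eventually.of_forall fun x => mul_nonneg (by positivity)
      (Finset.prod_nonneg fun j _ => npa_trunc_nonneg n c δ _))
    (hmeas.const_mul _).aestronglyMeasurable]
  have hpt : ∀ x : Fin m → EuclideanSpace ℝ (Fin n),
      ENNReal.ofReal (unitBallVol n ^ (-(2 * (k : ℝ) * c)) *
        ∏ j : Fin k, truncPower n c δ (∑ i : Fin m, (D i j : ℝ) • x i)) =
      ∏ j : Fin k, npaF n c δ (∑ i : Fin m, (D i j : ℝ) • x i) := by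
    intro x
    unfold npaF
    rw [← ENNReal.ofReal_prod_of_nonneg (fun j _ => mul_nonneg (by positivity)
      (npa_trunc_nonneg n c δ _)), Finset.prod_mul_distrib, hpow]
    simp
  simp_rw [hpt]
  refine (ENNReal.toReal_mono (by finiteness) hmain).trans ?_
  rw [ENNReal.toReal_mul, hr, ENNReal.toReal_ofReal (by positivity)]
  gcongr
  linarith
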